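/- If two virtual knots K and K' are related by a finite sequence of 2k-moves for every positive integer k, then K and K' are related by a finite sequence of Ξ-moves. -/

import Mathlib

/-!
Combinatorial Gauss diagrams.

A Gauss diagram is encoded as a list of chord endpoints read along the
oriented circle from a basepoint.  Each endpoint records the (natural number)
label of its chord, whether it is the terminal endpoint of the (oriented)
chord, and the sign of the chord (`true` = +1, `false` = -1).
Diagrams are considered up to rotation of the basepoint and relabeling of the
chords; these renamings are included among the "Reidemeister" generators.
-/

structure Endpoint where
  label : ℕ
  isTerminal : Bool
  sign : Bool
deriving DecidableEq

namespace Gauss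

/-- The sign (±1) of the chord through an endpoint. -/
def signValue (e : Endpoint) : ℤ := if e.sign then 1 else -1

/-- The sign assigned to an endpoint: `ε` at the terminal endpoint and `-ε`
at the initial endpoint of a chord of sign `ε`. -/
def endpointValue (e : Endpoint) : ℤ := if e.isTerminal then signValue e else -signValue e

/-- The list of chord labels of the endpoints of a word. -/
def labels (L : List Endpoint) : List ℕ := L.map Endpoint.label

/-- A word is a Gauss diagram when every chord label occurring in it occurs
exactly twice, once as an initial and once as a terminal endpoint, with the
same sign at both occurrences. -/
def IsGaussDiagram (L : List Endpoint) : Prop :=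
  ∀ e ∈ L, (L.filter (fun x => x.label == e.label)).length = 2 ∧
    ∃ e' ∈ L, e'.label = e.label ∧ e'.isTerminal = !e.isTerminal ∧ e'.sign = e.sign

/-- Rotate a word so that the first endpoint satisfying `p` comes first. -/
def rotateTo (L : List Endpoint) (p : Endpoint → Bool) : List Endpoint :=
  match L.findIdx? p with
  | some i => L.drop i ++ L.take i
  | none => L

/-- The index of the chord labeled `c`: the sum of the signs assigned to the
endpoints on the arc running from the initial endpoint of the chord to its
terminal endpoint in the direction of the circle's orientation. -/
def chordIndex (L : List Endpoint) (c : ℕ) : ℤ :=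
  ((((rotateTo L (fun e => e.label == c && !e.isTerminal)).drop 1).takeWhile
      (fun e => e.label != c)).map endpointValue).sum

/-- `Jn L n`: the sum of the signs of the chords of `L` of index `n`. -/
def Jn (L : List Endpoint) (n : ℤ) : ℤ :=
  ((L.filter (fun e => e.isTerminal && decide (chordIndex L e.label = n))).map signValue).sum

/-- The odd writhe: the sum of the signs of the chords of odd index,
i.e. `J = Σ_{n odd} J_n`. -/
def oddWrithe (L : List Endpoint) : ℤ :=
  ((L.filter (fun e => e.isTerminal && decide (chordIndex L e.label % 2 ≠ 0))).map signValue).sum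

/-- Moving the basepoint of the circle. -/
def rotateStep (L L' : List Endpoint) : Prop :=
  ∃ x xs, L = x :: xs ∧ L' = xs ++ [x]

/-- Injective relabeling of the chords. -/
def relabelStep (L L' : List Endpoint) : Prop :=
  ∃ f : ℕ → ℕ, Function.Injective f ∧
    L' = L.map (fun e => Endpoint.mk (f e.label) e.isTerminal e.sign)

/-- Reidemeister move I (removal direction): remove an isolated chord whose
two endpoints are adjacent (either orientation, either sign). -/
def reid1 (L L' : List Endpoint) : Prop :=
  ∃ (A B : List Endpoint) (c : ℕ) (t s : Bool),
    c ∉ labels (A ++ B) ∧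
    L = A ++ [Endpoint.mk c t s, Endpoint.mk c (!t) s] ++ B ∧
    L' = A ++ B

/-- Reidemeister move II (removal direction): remove two chords of opposite
signs whose initial endpoints are adjacent and whose terminal endpoints are
adjacent (in either of the two admissible orders). -/
def reid2 (L L' : List Endpoint) : Prop :=
  ∃ (A B C : List Endpoint) (c d : ℕ) (s crossed : Bool),
    c ≠ d ∧ c ∉ labels (A ++ B ++ C) ∧ d ∉ labels (A ++ B ++ C) ∧
    L = A ++ [Endpoint.mk c false s, Endpoint.mk d false (!s)] ++ B ++
        (if crossed then [Endpoint.mk c true s, Endpoint.mk d true (!s)]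
         else [Endpoint.mk d true (!s), Endpoint.mk c true s]) ++ C ∧
    L' = A ++ B ++ C

/-- Reidemeister move III (a standard variant; together with the moves I, II,
rotations and relabelings it generates all versions of the third move). -/
def reid3 (L L' : List Endpoint) : Prop :=
  ∃ (A B C D : List Endpoint) (a b c : ℕ) (s : Bool),
    a ≠ b ∧ b ≠ c ∧ a ≠ c ∧
    L = A ++ [Endpoint.mk b false s, Endpoint.mk a false s] ++ B ++
        [Endpoint.mk a true s, Endpoint.mk c false (!s)] ++ C ++
        [Endpoint.mk b true s, Endpoint.mk c true (!s)] ++ D ∧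
    L' = A ++ [Endpoint.mk a false s, Endpoint.mk b false s] ++ B ++
        [Endpoint.mk c false (!s), Endpoint.mk a true s] ++ C ++
        [Endpoint.mk c true (!s), Endpoint.mk b true s] ++ D

/-- A single Reidemeister generator (including diagram renamings). -/
def reidStep (L L' : List Endpoint) : Prop :=
  rotateStep L L' ∨ relabelStep L L' ∨ reid1 L L' ∨ reid2 L L' ∨ reid3 L L'

/-- A Ξ-move: exchange the first and third of three consecutive endpoints
belonging to three distinct chords, keeping all signs and orientations. -/
def xiStep (L L' : List Endpoint) : Prop :=
  ∃ (A B : List Endpoint) (x y z : Endpoint),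
    x.label ≠ y.label ∧ y.label ≠ z.label ∧ x.label ≠ z.label ∧
    L = A ++ [x, y, z] ++ B ∧
    L' = A ++ [z, y, x] ++ B

/-- A 2k-move (removal direction): remove `2k` chords `c 0, …, c (2k-1)`, all
of sign `s`, whose `p`-endpoints appear consecutively on one arc and whose
`q`-endpoints appear consecutively on a disjoint arc, the chord `c i` being
oriented from `p` to `q` for even `i` (the paper's odd `i`, 1-indexed) and
from `q` to `p` for odd `i`, so initial and terminal endpoints alternate. -/
def move2k (k : ℕ) (L L' : List Endpoint) : Prop :=
  ∃ (A B C : List Endpoint) (c : ℕ → ℕ) (s : Bool),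
    (∀ i < 2 * k, ∀ j < 2 * k, c i = c j → i = j) ∧
    (∀ i < 2 * k, c i ∉ labels (A ++ B ++ C)) ∧
    L = A ++ (List.range (2 * k)).map (fun i => Endpoint.mk (c i) (decide (i % 2 = 1)) s)
          ++ B ++
        (List.range (2 * k)).map (fun i => Endpoint.mk (c i) (decide (i % 2 = 0)) s)
          ++ C ∧
    L' = A ++ B ++ C

/-- A crossing change: reverse the sign and the orientation of one chord. -/
def crossingChange (L L' : List Endpoint) : Prop :=
  ∃ c : ℕ,
    L' = L.map (fun e =>
      if e.label = c then Endpoint.mk e.label (!e.isTerminal) (!e.sign) else e)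

/-- Finite sequences of moves from `r`, performed in either direction. -/
def Moves (r : List Endpoint → List Endpoint → Prop) :
    List Endpoint → List Endpoint → Prop :=
  Relation.ReflTransGen (fun L L' => r L L' ∨ r L' L)

/-- Related by Reidemeister moves: the two words represent the same virtual knot. -/
def ReidEquiv : List Endpoint → List Endpoint → Prop := Moves reidStep

/-- Related by a finite sequence of 2k-moves (and Reidemeister moves). -/
def Rel2k (k : ℕ) : List Endpoint → List Endpoint → Prop :=
  Moves (fun L L' => reidStep L L' ∨ move2k k L L')

/-- Related by a finite sequence of Ξ-moves (and Reidemeister moves). -/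
def RelXi : List Endpoint → List Endpoint → Prop :=
  Moves (fun L L' => reidStep L L' ∨ xiStep L L')

/-- Related by a finite sequence of 2k-moves and Ξ-moves (and Reidemeister moves). -/
def Rel2kXi (k : ℕ) : List Endpoint → List Endpoint → Prop :=
  Moves (fun L L' => reidStep L L' ∨ move2k k L L' ∨ xiStep L L')

/-- Related by a finite sequence of crossing changes and Ξ-moves
(and Reidemeister moves). -/
def RelCCXi : List Endpoint → List Endpoint → Prop :=
  Moves (fun L L' => reidStep L L' ∨ crossingChange L L' ∨ xiStep L L')

/-- A shell-pair of sign `s`: two chords `c`, `d` of sign `s` whose four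
endpoints are consecutive, interleaved as 1st-3rd and 2nd-4th
(with arbitrary orientations `t`, `u` of the two shells). -/
def shellPair (c d : ℕ) (t u s : Bool) : List Endpoint :=
  [Endpoint.mk c t s, Endpoint.mk d u s, Endpoint.mk c (!t) s, Endpoint.mk d (!u) s]

/-- The Gauss diagram `G(a)`: `|a|` consecutive shell-pairs of sign `+1` if
`a > 0` and of sign `-1` if `a < 0`; `G(0)` has no chords.  It represents the
virtual knot `K(a)`. -/
def Gword (a : ℤ) : List Endpoint :=
  ((List.range a.natAbs).map
    (fun j => shellPair (2 * j) (2 * j + 1) false false (decide (0 < a)))).flatten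

/-- `Rel2kCount k m G G'`: `G` and `G'` are related by a finite sequence of
Reidemeister moves and exactly `m` 2k-moves. -/
inductive Rel2kCount (k : ℕ) : ℕ → List Endpoint → List Endpoint → Prop
  | refl (L : List Endpoint) : Rel2kCount k 0 L L
  | reid {m : ℕ} {L L' L'' : List Endpoint} :
      reidStep L L' ∨ reidStep L' L →
      Rel2kCount k m L' L'' → Rel2kCount k m L L''
  | move {m : ℕ} {L L' L'' : List Endpoint} :
      move2k k L L' ∨ move2k k L' L →
      Rel2kCount k m L' L'' → Rel2kCount k (m + 1) L L''

/-- The 2k-move distance: the minimal number of 2k-moves needed to relate the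
two diagrams (together with Reidemeister moves). -/
noncomputable def dist2k (k : ℕ) (L L' : List Endpoint) : ℕ :=
  sInf {m | Rel2kCount k m L L'}

end Gauss

namespace Gauss

/-! ### Part 1: an invariant -/

/-- Alternating count of the occurrences of a label. -/
def alt (c : ℕ) : List Endpoint → ℤ
  | [] => 0
  | x :: xs => (if x.label = c then 1 else 0) - alt c xs

/-- Eight times the odd writhe. -/
def KK (L : List Endpoint) : ℤ := (L.map (fun e => signValue e * (alt e.label L) ^ 2)).sum

lemma alt_append (c : ℕ) (A B : List Endpoint) :
    alt c (A ++ B) = alt c A + (-1) ^ A.length * alt c B := by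
  induction A with
  | nil => simp [alt]
  | cons x xs ih => simp only [List.cons_append, alt, ih, List.length_cons, pow_succ]; ring

lemma alt_not_mem (c : ℕ) (A : List Endpoint) (h : c ∉ labels A) : alt c A = 0 := by
  induction A with
  | nil => rfl
  | cons x xs ih =>
    simp only [labels, List.map_cons, List.mem_cons, not_or] at h
    have := ih h.2
    simp [alt, this, Ne.symm h.1]

lemma labels_append (A B : List Endpoint) : labels (A ++ B) = labels A ++ labels B := by
  simp [labels]

lemma mem_labels {e : Endpoint} {A : List Endpoint} (h : e ∈ A) : e.label ∈ labels A :=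
  List.mem_map_of_mem h

lemma KK_perm {L L' : List Endpoint} (h : L.Perm L') (h2 : ∀ c, alt c L ^ 2 = alt c L' ^ 2) :
    KK L = KK L' := by
  unfold KK
  rw [List.Perm.sum_eq (h.map _)]
  simp only [h2]

lemma negpow_even {n : ℕ} (h : Even n) : (-1 : ℤ) ^ n = 1 := h.neg_one_pow

lemma KK_insert (A X B Y C : List Endpoint) (hX : Even X.length) (hY : Even Y.length)
    (hd : ∀ e ∈ X ++ Y, e.label ∉ labels (A ++ B ++ C)) :
    KK (A ++ X ++ B ++ Y ++ C) = KK (A ++ B ++ C) +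
      ((X ++ Y).map (fun e => signValue e * (alt e.label (A ++ X ++ B ++ Y ++ C)) ^ 2)).sum := by
  have hp : (A ++ X ++ B ++ Y ++ C).Perm ((A ++ B ++ C) ++ (X ++ Y)) := by
    rw [List.perm_iff_count]; intro a; simp only [List.count_append]; omega
  have key : ∀ e ∈ A ++ B ++ C,
      alt e.label (A ++ X ++ B ++ Y ++ C) = alt e.label (A ++ B ++ C) := by
    intro e he
    have hl := mem_labels he
    have h1 : alt e.label X = 0 := by
      apply alt_not_mem
      intro hc
      obtain ⟨f, hf, hfe⟩ := List.mem_map.1 hc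
      exact hd f (by simp [hf]) (hfe ▸ hl)
    have h2 : alt e.label Y = 0 := by
      apply alt_not_mem
      intro hc
      obtain ⟨f, hf, hfe⟩ := List.mem_map.1 hc
      exact hd f (by simp [hf]) (hfe ▸ hl)
    simp only [alt_append, h1, h2, List.length_append, pow_add, negpow_even hX, negpow_even hY]
    ring
  unfold KK
  rw [List.Perm.sum_eq (hp.map _), List.map_append, List.sum_append]
  congr 1
  congr 1
  apply List.map_congr_left
  intro e he
  rw [key e he]

/-- Weak form of being a Gauss diagram. -/
def WW (L : List Endpoint) : Prop := Even L.length ∧ ∀ c, (labels L).count c ≤ 2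

lemma WW_perm {L L' : List Endpoint} (h : L.Perm L') : WW L ↔ WW L' := by
  unfold WW
  rw [h.length_eq]
  have : ∀ c, (labels L).count c = (labels L').count c := fun c => (h.map _).count_eq c
  simp only [this]

lemma WW_insert (A X B Y C : List Endpoint) (hX : Even (X ++ Y).length)
    (hd : ∀ e ∈ X ++ Y, e.label ∉ labels (A ++ B ++ C))
    (hc : ∀ c, (labels (X ++ Y)).count c ≤ 2) :
    WW (A ++ X ++ B ++ Y ++ C) ↔ WW (A ++ B ++ C) := by
  have hp : (A ++ X ++ B ++ Y ++ C).Perm ((A ++ B ++ C) ++ (X ++ Y)) := by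
    rw [List.perm_iff_count]; intro a; simp only [List.count_append]; omega
  rw [WW_perm hp]
  unfold WW
  rw [List.length_append, Nat.even_add]
  simp only [hX, iff_true]
  refine and_congr_right fun _ => forall_congr' fun c => ?_
  rw [labels_append (A ++ B ++ C), List.count_append]
  constructor
  · intro h; omega
  · intro h
    by_cases hm : c ∈ labels (X ++ Y)
    · obtain ⟨f, hf, hfe⟩ := List.mem_map.1 hm
      have := hd f hf
      rw [hfe] at this
      rw [List.count_eq_zero_of_not_mem this]
      have := hc c
      omega
    · rw [List.count_eq_zero_of_not_mem hm]; omega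

/-- The statement that a move preserves `WW` and `KK` modulo `k`. -/
def Pres (k : ℤ) (L L' : List Endpoint) : Prop := (WW L ↔ WW L') ∧ (WW L → k ∣ KK L - KK L')

lemma Pres_of_eq {k : ℤ} {L L' : List Endpoint} (h : WW L ↔ WW L')
    (h2 : WW L → KK L = KK L') : Pres k L L' :=
  ⟨h, fun hw => by rw [h2 hw]; simp⟩

lemma pres_rotate (k : ℤ) {L L' : List Endpoint} (h : rotateStep L L') : Pres k L L' := by
  obtain ⟨x, xs, rfl, rfl⟩ := h
  have hp : (x :: xs).Perm (xs ++ [x]) := (List.perm_append_singleton x xs).symm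
  refine Pres_of_eq (WW_perm hp) fun hw => KK_perm hp fun c => ?_
  have h1 : Odd xs.length := by
    have := hw.1
    simp only [List.length_cons] at this
    exact Nat.not_even_iff_odd.1 (Nat.even_add_one.1 this)
  rw [alt_append, h1.neg_one_pow]
  simp only [alt]
  ring

lemma alt_relabel (f : ℕ → ℕ) (hf : Function.Injective f) (c : ℕ) (L : List Endpoint) :
    alt (f c) (L.map (fun e => Endpoint.mk (f e.label) e.isTerminal e.sign)) = alt c L := by
  induction L with
  | nil => rfl
  | cons x xs ih => simp only [List.map_cons, alt, ih, hf.eq_iff]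

lemma pres_relabel (k : ℤ) {L L' : List Endpoint} (h : relabelStep L L') : Pres k L L' := by
  obtain ⟨f, hf, rfl⟩ := h
  apply Pres_of_eq
  · unfold WW
    have hl : labels (L.map (fun e => Endpoint.mk (f e.label) e.isTerminal e.sign))
        = (labels L).map f := by simp [labels, Function.comp_def]
    rw [hl, List.length_map]
    refine and_congr_right fun _ => ?_
    constructor
    · intro h c
      by_cases hm : c ∈ (labels L).map f
      · obtain ⟨a, -, rfl⟩ := List.mem_map.1 hm
        rw [List.count_map_of_injective _ _ hf]
        exact h a
      · rw [List.count_eq_zero_of_not_mem hm]; omega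
    · intro h c
      have := h (f c)
      rwa [List.count_map_of_injective _ _ hf] at this
  · intro _
    unfold KK
    rw [List.map_map]
    congr 1
    apply List.map_congr_left
    intro e _
    simp only [Function.comp, alt_relabel f hf]
    rfl

lemma pres_reid1 (k : ℤ) {L L' : List Endpoint} (h : reid1 L L') : Pres k L L' := by
  obtain ⟨A, B, c, t, s, hc, rfl, rfl⟩ := h
  have hd : ∀ e ∈ [Endpoint.mk c t s, Endpoint.mk c (!t) s] ++ [],
      e.label ∉ labels (A ++ B ++ []) := by
    intro e he
    simp only [List.append_nil, List.mem_cons, List.not_mem_nil, or_false] at he ⊢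
    rcases he with rfl | rfl <;> exact hc
  have hW := WW_insert A [Endpoint.mk c t s, Endpoint.mk c (!t) s] B [] [] (by simp) hd
    (fun c => List.count_le_length)
  have hK := KK_insert A [Endpoint.mk c t s, Endpoint.mk c (!t) s] B [] [] (by simp) (by simp) hd
  simp only [List.append_nil] at hW hK
  refine Pres_of_eq hW fun _ => ?_
  rw [hK]
  rw [labels_append, List.mem_append, not_or] at hc
  simp [alt_append, alt, alt_not_mem c A hc.1, alt_not_mem c B hc.2]

lemma pres_reid2 (k : ℤ) {L L' : List Endpoint} (h : reid2 L L') : Pres k L L' := by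
  obtain ⟨A, B, C, c, d, s, cr, hcd, hc, hd, rfl, rfl⟩ := h
  set X := [Endpoint.mk c false s, Endpoint.mk d false (!s)] with hX
  set Y := (if cr then [Endpoint.mk c true s, Endpoint.mk d true (!s)]
         else [Endpoint.mk d true (!s), Endpoint.mk c true s]) with hY
  have hYl : Y.length = 2 := by rw [hY]; split <;> rfl
  have hdd : ∀ e ∈ X ++ Y, e.label ∉ labels (A ++ B ++ C) := by
    intro e he
    rw [hX, hY] at he
    cases cr <;> simp at he <;> rcases he with rfl | rfl | rfl | rfl <;> assumption
  have hW := WW_insert A X B Y C (by simp [hX, hYl]; decide) hdd (by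
    intro e
    rw [hX, hY]
    cases cr <;> simp [labels, List.count_cons] <;> grind)
  refine Pres_of_eq hW fun _ => ?_
  rw [KK_insert A X B Y C (by simp [hX]) (by simp [hYl]) hdd]
  simp only [labels_append, List.mem_append, not_or] at hc hd
  obtain ⟨⟨hc1, hc2⟩, hc3⟩ := hc
  obtain ⟨⟨hd1, hd2⟩, hd3⟩ := hd
  have hsq : alt c (A ++ X ++ B ++ Y ++ C) ^ 2 = alt d (A ++ X ++ B ++ Y ++ C) ^ 2 := by
    simp only [alt_append, alt_not_mem _ _ hc1, alt_not_mem _ _ hc2, alt_not_mem _ _ hc3,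
      alt_not_mem _ _ hd1, alt_not_mem _ _ hd2, alt_not_mem _ _ hd3]
    rw [hX, hY]
    cases cr <;> simp [alt, hcd, hcd.symm] <;> ring
  have : ((X ++ Y).map (fun e => signValue e * (alt e.label (A ++ X ++ B ++ Y ++ C)) ^ 2)).sum
      = 0 := by
    generalize (A ++ X ++ B ++ Y ++ C) = M at hsq ⊢
    rw [hX, hY]
    cases cr <;> cases s <;> simp [signValue, hsq]
  rw [this, add_zero]

set_option linter.unusedSimpArgs false in
lemma pres_reid3 (k : ℤ) {L L' : List Endpoint} (h : reid3 L L') : Pres k L L' := by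
  obtain ⟨A, B, C, D, a, b, c, s, hab, hbc, hac, rfl, rfl⟩ := h
  have hp : (A ++ [Endpoint.mk b false s, Endpoint.mk a false s] ++ B ++
        [Endpoint.mk a true s, Endpoint.mk c false (!s)] ++ C ++
        [Endpoint.mk b true s, Endpoint.mk c true (!s)] ++ D).Perm
      (A ++ [Endpoint.mk a false s, Endpoint.mk b false s] ++ B ++
        [Endpoint.mk c false (!s), Endpoint.mk a true s] ++ C ++
        [Endpoint.mk c true (!s), Endpoint.mk b true s] ++ D) := by
    rw [List.perm_iff_count]; intro e
    simp only [List.count_append, List.count_cons, List.count_nil]; omega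
  refine Pres_of_eq (WW_perm hp) fun hw => KK_perm hp fun e => ?_
  have h2 := hw.2
  simp only [labels_append, List.count_append] at h2
  have key : ∀ x, (x = a ∨ x = b ∨ x = c) → alt x A = 0 ∧ alt x B = 0 ∧ alt x C = 0 ∧ alt x D = 0 := by
    intro x hx
    have h3 := h2 x
    have : (labels A).count x = 0 ∧ (labels B).count x = 0 ∧ (labels C).count x = 0 ∧
        (labels D).count x = 0 := by
      rcases hx with rfl | rfl | rfl <;>
      simp [labels, hab, hbc, hac, hab.symm, hbc.symm, hac.symm] at h3 ⊢ <;>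
      grind
    simp only [List.count_eq_zero] at this
    exact ⟨alt_not_mem _ _ this.1, alt_not_mem _ _ this.2.1, alt_not_mem _ _ this.2.2.1,
      alt_not_mem _ _ this.2.2.2⟩
  by_cases ha : e = a
  · subst ha
    obtain ⟨h1, h2, h3, h4⟩ := key e (by simp)
    simp [alt_append, h1, h2, h3, h4, alt, hab, hbc, hac, hab.symm, hbc.symm, hac.symm]
    ring
  by_cases hb : e = b
  · subst hb
    obtain ⟨h1, h2, h3, h4⟩ := key e (by simp)
    simp [alt_append, h1, h2, h3, h4, alt, hab, hbc, hac, hab.symm, hbc.symm, hac.symm]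
    ring
  by_cases hc : e = c
  · subst hc
    obtain ⟨h1, h2, h3, h4⟩ := key e (by simp)
    simp [alt_append, h1, h2, h3, h4, alt, hab, hbc, hac, hab.symm, hbc.symm, hac.symm]
    ring
  simp [alt_append, alt, Ne.symm ha, Ne.symm hb, Ne.symm hc]

lemma pres_xi (k : ℤ) {L L' : List Endpoint} (h : xiStep L L') : Pres k L L' := by
  obtain ⟨A, B, x, y, z, -, -, -, rfl, rfl⟩ := h
  have hp : (A ++ [x, y, z] ++ B).Perm (A ++ [z, y, x] ++ B) := by
    rw [List.perm_iff_count]; intro e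
    simp only [List.count_append, List.count_cons, List.count_nil]; omega
  refine Pres_of_eq (WW_perm hp) fun hw => KK_perm hp fun e => ?_
  simp only [alt_append, alt, List.length_append, List.length_cons]
  ring

lemma alt_range (c : ℕ → ℕ) (t : ℕ → Bool) (s : Bool) (m i : ℕ) (hi : i < m)
    (hc : ∀ i < m, ∀ j < m, c i = c j → i = j) (n : ℕ) (hn : n ≤ m) :
    alt (c i) ((List.range n).map (fun j => Endpoint.mk (c j) (t j) s)) =
      if i < n then (-1) ^ i else 0 := by
  induction n with
  | zero => simp [alt]
  | succ n ih =>
    rw [List.range_succ, List.map_append, alt_append, ih (by omega)]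
    simp only [List.map_cons, List.map_nil, alt, List.length_map, List.length_range]
    by_cases h : i = n
    · subst h; simp
    · have : c n ≠ c i := fun h' => h (hc n (by omega) i hi h').symm
      have h3 : (i < n + 1) ↔ i < n := by omega
      simp [this, h3]

lemma pres_move2k (k : ℕ) {L L' : List Endpoint} (h : move2k k L L') : Pres k L L' := by
  obtain ⟨A, B, C, c, s, hinj, hfresh, rfl, rfl⟩ := h
  set X := (List.range (2 * k)).map (fun i => Endpoint.mk (c i) (decide (i % 2 = 1)) s) with hX
  set Y := (List.range (2 * k)).map (fun i => Endpoint.mk (c i) (decide (i % 2 = 0)) s) with hY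
  have hXl : X.length = 2 * k := by simp [hX]
  have hYl : Y.length = 2 * k := by simp [hY]
  have hd : ∀ e ∈ X ++ Y, ∃ i < 2 * k, e.label = c i ∧ e.sign = s := by
    intro e he
    rw [hX, hY] at he
    simp only [List.mem_append, List.mem_map, List.mem_range] at he
    rcases he with ⟨i, hi, rfl⟩ | ⟨i, hi, rfl⟩ <;> exact ⟨i, hi, rfl, rfl⟩
  have hdd : ∀ e ∈ X ++ Y, e.label ∉ labels (A ++ B ++ C) := by
    intro e he
    obtain ⟨i, hi, h, -⟩ := hd e he
    rw [h]; exact hfresh i hi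
  have hnd : ((List.range (2 * k)).map c).Nodup := by
    apply List.Nodup.map_on _ List.nodup_range
    intro i hi j hj
    exact hinj i (List.mem_range.1 hi) j (List.mem_range.1 hj)
  have hlX : labels X = (List.range (2 * k)).map c := by simp [hX, labels, Function.comp_def]
  have hlY : labels Y = (List.range (2 * k)).map c := by simp [hY, labels, Function.comp_def]
  refine ⟨WW_insert A X B Y C (by simp [hXl, hYl]) hdd (fun e => ?_), fun _ => ?_⟩
  · rw [labels_append, List.count_append, hlX, hlY]
    have := List.nodup_iff_count_le_one.1 hnd e
    omega
  rw [KK_insert A X B Y C (by simp [hXl]) (by simp [hYl]) hdd, add_sub_cancel_left]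
  have hconst : ∀ e ∈ X ++ Y, signValue e * (alt e.label (A ++ X ++ B ++ Y ++ C)) ^ 2 =
      (if s then 1 else -1) * (1 + (-1) ^ B.length) ^ 2 := by
    intro e he
    obtain ⟨i, hi, h, hs⟩ := hd e he
    have hf := hfresh i hi
    simp only [labels_append, List.mem_append, not_or] at hf
    obtain ⟨⟨h1, h2⟩, h3⟩ := hf
    have e1 : alt (c i) X = (-1) ^ i := by
      rw [hX, alt_range c _ s _ i hi hinj _ le_rfl, if_pos hi]
    have e2 : alt (c i) Y = (-1) ^ i := by
      rw [hY, alt_range c _ s _ i hi hinj _ le_rfl, if_pos hi]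
    have e3 : ∀ n : ℕ, ((-1 : ℤ) ^ n) ^ 2 = 1 := fun n => by rw [← pow_mul, mul_comm]; simp
    have e4 : (-1 : ℤ) ^ (2 * k) = 1 := by simp
    rw [h]
    simp only [signValue, hs, alt_append, alt_not_mem _ _ h1, alt_not_mem _ _ h2,
      alt_not_mem _ _ h3, e1, e2, List.length_append, pow_add, hXl, e4]
    have : (0 + (-1) ^ A.length * (-1) ^ i + (-1) ^ A.length * 1 * 0 + (-1) ^ A.length * 1 * (-1) ^ B.length * (-1) ^ i + 0 : ℤ) ^ 2
      = ((-1) ^ A.length) ^ 2 * ((-1) ^ i) ^ 2 * (1 + (-1) ^ B.length) ^ 2 := by ring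
    rw [mul_zero, add_zero] at *
    rw [e3, e3] at this
    simp only [one_mul, mul_one, mul_zero, add_zero, zero_add] at this ⊢
    rw [this]
  rw [List.map_congr_left hconst, List.map_const', List.sum_replicate]
  simp only [List.length_append, hXl, hYl, nsmul_eq_mul]
  push_cast
  exact ⟨4 * ((if s then 1 else -1) * (1 + (-1) ^ B.length) ^ 2), by ring⟩

lemma Pres.symm {k : ℤ} {L L' : List Endpoint} (h : Pres k L L') : Pres k L' L :=
  ⟨h.1.symm, fun hw => by
    have := h.2 (h.1.2 hw)
    rw [← neg_sub]; exact (dvd_neg).2 this⟩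

lemma Pres.trans {k : ℤ} {L L' L'' : List Endpoint} (h : Pres k L L') (h' : Pres k L' L'') :
    Pres k L L'' :=
  ⟨h.1.trans h'.1, fun hw => by
    have := dvd_add (h.2 hw) (h'.2 (h.1.1 hw))
    simpa using this⟩

lemma pres_reid (k : ℤ) {L L' : List Endpoint} (h : reidStep L L') : Pres k L L' := by
  rcases h with h | h | h | h | h
  · exact pres_rotate k h
  · exact pres_relabel k h
  · exact pres_reid1 k h
  · exact pres_reid2 k h
  · exact pres_reid3 k h

lemma pres_moves {k : ℤ} {r : List Endpoint → List Endpoint → Prop}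
    (hr : ∀ L L', r L L' → Pres k L L') {L L' : List Endpoint} (h : Moves r L L') :
    Pres k L L' := by
  induction h with
  | refl => exact ⟨Iff.rfl, fun _ => by simp⟩
  | tail _ h ih =>
    rcases h with h | h
    · exact ih.trans (hr _ _ h)
    · exact ih.trans (hr _ _ h).symm

lemma KK_eq_of_rel2k {G G' : List Endpoint} (hG : WW G)
    (h : ∀ k : ℕ, 0 < k → Rel2k k G G') : KK G = KK G' := by
  have h1 : ∀ k : ℕ, 0 < k → (k : ℤ) ∣ KK G - KK G' := fun k hk =>
    (pres_moves (k := k) (fun L L' hL => hL.elim (pres_reid k) (pres_move2k k)) (h k hk)).2 hG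
  have h2 := h1 ((KK G - KK G').natAbs + 1) (by omega)
  have := Int.eq_zero_of_dvd_of_natAbs_lt_natAbs h2 (by omega)
  omega

lemma KK_eq_of_relXi {G G' : List Endpoint} (hG : WW G) (h : RelXi G G') : KK G = KK G' := by
  have := (pres_moves (k := 0) (fun L L' hL => hL.elim (pres_reid 0) (pres_xi 0)) h).2 hG
  rw [zero_dvd_iff] at this
  omega

end Gauss

namespace Gauss

/-! ### Part 2: reduction to a normal form -/

lemma RelXi.trans {L L' L'' : List Endpoint} (h : RelXi L L') (h' : RelXi L' L'') :
    RelXi L L'' := Relation.ReflTransGen.trans h h'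

lemma RelXi.symm {L L' : List Endpoint} (h : RelXi L L') : RelXi L' L := by
  unfold RelXi Moves at *
  induction h with
  | refl => exact .refl
  | tail _ h ih => exact .head h.symm ih

lemma RelXi.rfl' (L : List Endpoint) : RelXi L L := .refl

lemma RelXi.of_reid {L L' : List Endpoint} (h : reidStep L L') : RelXi L L' :=
  .single (Or.inl (Or.inl h))

lemma RelXi.of_xi {L L' : List Endpoint} (h : xiStep L L') : RelXi L L' :=
  .single (Or.inl (Or.inr h))

lemma relXi_rotate (A B : List Endpoint) : RelXi (A ++ B) (B ++ A) := by
  induction A generalizing B with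
  | nil => simpa using RelXi.rfl' B
  | cons x xs ih =>
    have h1 : RelXi (x :: xs ++ B) (xs ++ (B ++ [x])) :=
      .of_reid (Or.inl ⟨x, xs ++ B, by simp, by simp⟩)
    have h2 := ih (B ++ [x])
    simpa using h1.trans h2

lemma G_perm {L L' : List Endpoint} (h : L.Perm L') (hG : IsGaussDiagram L) :
    IsGaussDiagram L' := by
  intro e he
  obtain ⟨h1, e', h2, h3⟩ := hG e (h.mem_iff.2 he)
  exact ⟨by rw [← h1]; exact (h.filter _).length_eq.symm, e', h.mem_iff.1 h2, h3⟩

lemma G_pair {x x' : Endpoint} {M : List Endpoint} (h : IsGaussDiagram (x :: x' :: M))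
    (hl : x'.label = x.label) :
    (∀ e ∈ M, e.label ≠ x.label) ∧ x' = ⟨x.label, !x.isTerminal, x.sign⟩ ∧
      IsGaussDiagram M := by
  obtain ⟨h1, e', h2, h3, h4, h5⟩ := h x (by simp)
  have hM : ∀ e ∈ M, e.label ≠ x.label := by
    simpa [List.filter_cons, hl] using h1
  refine ⟨hM, ?_, ?_⟩
  · simp only [List.mem_cons] at h2
    rcases h2 with rfl | rfl | h2
    · simp at h4
    · rw [← h3, ← h4, ← h5]
    · exact absurd h3 (hM e' h2)
  · intro e he
    have hne := hM e he
    obtain ⟨g1, f, g2, g3, g4⟩ := h e (by simp [he])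
    have hne' : ¬ x.label = e.label := fun h => hne h.symm
    refine ⟨by simpa [List.filter_cons, hl, hne'] using g1, f, ?_, g3, g4⟩
    simp only [List.mem_cons] at g2
    rcases g2 with rfl | rfl | g2
    · exact absurd g3 hne'
    · exact absurd (hl.symm.trans g3) hne'
    · exact g2

lemma G_partner {x : Endpoint} {R : List Endpoint} (h : IsGaussDiagram (x :: R)) :
    ∃ w B, R = w ++ ⟨x.label, !x.isTerminal, x.sign⟩ :: B := by
  obtain ⟨h1, e', h2, h3, h4, h5⟩ := h x (by simp)
  have he : e' = ⟨x.label, !x.isTerminal, x.sign⟩ := by rw [← h3, ← h4, ← h5]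
  simp only [List.mem_cons] at h2
  rcases h2 with rfl | h2
  · simp at h4
  · rw [← he]
    exact List.append_of_mem h2

/-- Permutation helper. -/
lemma perm_of_count {L L' : List Endpoint} (h : ∀ a, L.count a = L'.count a) : L.Perm L' :=
  List.perm_iff_count.2 h

lemma G_even : ∀ (n : ℕ) (L : List Endpoint), L.length ≤ n → IsGaussDiagram L →
    Even L.length := by
  intro n
  induction n with
  | zero => intro L h _; have : L.length = 0 := by omega
            simp [this]
  | succ n ih =>
    intro L hn hG
    cases L with
    | nil => simp
    | cons x R =>
      obtain ⟨w, B, rfl⟩ := G_partner hG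
      have hp : (x :: (w ++ ⟨x.label, !x.isTerminal, x.sign⟩ :: B)).Perm
          (x :: ⟨x.label, !x.isTerminal, x.sign⟩ :: (w ++ B)) :=
        List.Perm.cons _ List.perm_middle
      obtain ⟨-, -, h3⟩ := G_pair (G_perm hp hG) rfl
      rw [hp.length_eq] at hn ⊢
      have := ih (w ++ B) (by simp at hn ⊢; omega) h3
      simp only [List.length_cons]
      grind

lemma G_WW {L : List Endpoint} (h : IsGaussDiagram L) : WW L := by
  refine ⟨G_even _ L le_rfl h, fun c => ?_⟩
  by_cases hc : c ∈ labels L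
  · obtain ⟨e, he, rfl⟩ := List.mem_map.1 hc
    have := (h e he).1
    rw [labels, List.count_eq_countP, List.countP_map, List.countP_eq_length_filter]
    exact this.le
  · rw [List.count_eq_zero_of_not_mem hc]; omega

lemma relXi_reid1 (A B : List Endpoint) (c : ℕ) (t s : Bool)
    (h : ∀ e ∈ A ++ B, e.label ≠ c) :
    RelXi (A ++ [Endpoint.mk c t s, Endpoint.mk c (!t) s] ++ B) (A ++ B) := by
  refine .of_reid (Or.inr (Or.inr (Or.inl ⟨A, B, c, t, s, ?_, rfl, rfl⟩)))
  intro hc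
  obtain ⟨e, he, h'⟩ := List.mem_map.1 hc
  exact h e he h'

lemma gswap (A B : List Endpoint) (x y z : Endpoint)
    (hG : IsGaussDiagram (A ++ [x, y, z] ++ B)) (hxz : x.label ≠ z.label) :
    RelXi (A ++ [x, y, z] ++ B) (A ++ [z, y, x] ++ B) := by
  by_cases hxy : y.label = x.label
  · have hp : (A ++ [x, y, z] ++ B).Perm (x :: y :: (A ++ [z] ++ B)) := by
      apply perm_of_count; intro a
      simp only [List.count_append, List.count_cons, List.count_nil]; omega
    obtain ⟨h1, h2, -⟩ := G_pair (G_perm hp hG) hxy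
    have r1 := relXi_reid1 A ([z] ++ B) x.label x.isTerminal x.sign (by simpa using h1)
    have r2 := relXi_reid1 (A ++ [z]) B x.label (!x.isTerminal) x.sign (by simpa using h1)
    rw [Bool.not_not] at r2
    rw [h2]
    simpa using r1.trans (by simpa using r2.symm)
  by_cases hyz : z.label = y.label
  · have hp : (A ++ [x, y, z] ++ B).Perm (y :: z :: (A ++ [x] ++ B)) := by
      apply perm_of_count; intro a
      simp only [List.count_append, List.count_cons, List.count_nil]; omega
    obtain ⟨h1, h2, -⟩ := G_pair (G_perm hp hG) hyz
    have r1 := relXi_reid1 (A ++ [x]) B y.label y.isTerminal y.sign (by simpa using h1)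
    have r2 := relXi_reid1 A ([x] ++ B) y.label (!y.isTerminal) y.sign (by simpa using h1)
    rw [Bool.not_not] at r2
    rw [h2]
    simpa using r1.trans (by simpa using r2.symm)
  exact .of_xi ⟨A, B, x, y, z, fun h => hxy h.symm, fun h => hyz h.symm, hxz, rfl, rfl⟩

/-- Swap the entries of a word pairwise. -/
def psw : List Endpoint → List Endpoint
  | a :: b :: l => b :: a :: psw l
  | [a] => [a]
  | [] => []

lemma psw_perm : ∀ l, (psw l).Perm l
  | a :: b :: l => by
    rw [psw]
    exact (List.Perm.swap _ _ _).trans (((psw_perm l).cons b).cons a)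
  | [a] => by rw [psw]
  | [] => by rw [psw]

lemma psw_psw : ∀ l, psw (psw l) = l
  | a :: b :: l => by rw [psw, psw, psw_psw l]
  | [a] => by rw [psw, psw]
  | [] => by rw [psw, psw]

lemma moveR : ∀ (w A B : List Endpoint) (x : Endpoint), Even w.length →
    IsGaussDiagram (A ++ x :: (w ++ B)) → (∀ e ∈ w, e.label ≠ x.label) →
    RelXi (A ++ x :: (w ++ B)) (A ++ psw w ++ x :: B)
  | a :: b :: l => by
    intro A B x hw hG hx
    have h1 := gswap A (l ++ B) x a b (by simpa using hG) (hx b (by simp)).symm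
    have hp : (A ++ x :: (a :: b :: l ++ B)).Perm ((A ++ [b, a]) ++ x :: (l ++ B)) := by
      apply perm_of_count; intro e
      simp only [List.count_append, List.count_cons, List.count_nil]; omega
    have h2 := moveR l (A ++ [b, a]) B x
      (by simp only [List.length_cons] at hw; grind) (G_perm hp hG)
      (fun e he => hx e (by simp [he]))
    rw [psw]
    have h1' : RelXi (A ++ x :: (a :: b :: l ++ B)) ((A ++ [b, a]) ++ x :: (l ++ B)) := by
      simpa using h1
    simpa using h1'.trans h2
  | [a] => by intro A B x hw; simp at hw
  | [] => by intro A B x _ _ _; simpa [psw] using RelXi.rfl' _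

lemma moveL (w A B : List Endpoint) (x : Endpoint) (hw : Even w.length)
    (hG : IsGaussDiagram (A ++ w ++ x :: B)) (hx : ∀ e ∈ w, e.label ≠ x.label) :
    RelXi (A ++ w ++ x :: B) (A ++ x :: (psw w ++ B)) := by
  have hp : (A ++ w ++ x :: B).Perm (A ++ x :: (psw w ++ B)) := by
    apply perm_of_count; intro e
    simp only [List.count_append, List.count_cons, (psw_perm w).count_eq]; omega
  have := moveR (psw w) A B x (by rwa [(psw_perm w).length_eq]) (G_perm hp hG)
    (fun e he => hx e ((psw_perm w).mem_iff.1 he))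
  rw [psw_psw] at this
  exact this.symm

lemma evenRem (A w B : List Endpoint) (x : Endpoint) (hw : Even w.length)
    (hG : IsGaussDiagram (A ++ x :: (w ++ ⟨x.label, !x.isTerminal, x.sign⟩ :: B))) :
    RelXi (A ++ x :: (w ++ ⟨x.label, !x.isTerminal, x.sign⟩ :: B)) (A ++ psw w ++ B) ∧
    IsGaussDiagram (A ++ psw w ++ B) := by
  have hp : (A ++ x :: (w ++ ⟨x.label, !x.isTerminal, x.sign⟩ :: B)).Perm
      (x :: ⟨x.label, !x.isTerminal, x.sign⟩ :: (A ++ psw w ++ B)) := by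
    apply perm_of_count; intro e
    simp only [List.count_append, List.count_cons, (psw_perm w).count_eq]; omega
  obtain ⟨h1, -, h3⟩ := G_pair (G_perm hp hG) rfl
  refine ⟨?_, h3⟩
  have r1 := moveR w A _ x hw hG (fun e he => h1 e (by simp [(psw_perm w).mem_iff, he]))
  have r2 := relXi_reid1 (A ++ psw w) B x.label x.isTerminal x.sign h1
  refine r1.trans ?_
  simpa using r2

/-- Two interleaved chords with four consecutive endpoints. -/
structure Blk where
  c : ℕ
  d : ℕ
  t : Bool
  u : Bool
  s : Bool
  r : Bool

/-- The word of a block. -/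
def bw (b : Blk) : List Endpoint := [⟨b.c, b.t, b.s⟩, ⟨b.d, b.u, b.r⟩, ⟨b.c, !b.t, b.s⟩, ⟨b.d, !b.u, b.r⟩]

/-- The word of a list of blocks. -/
def word (B : List Blk) : List Endpoint := B.flatMap bw

@[simp] lemma word_append (B C : List Blk) : word (B ++ C) = word B ++ word C := by
  simp [word]

@[simp] lemma word_cons (b : Blk) (C : List Blk) : word (b :: C) = bw b ++ word C := by
  simp [word]

@[simp] lemma word_nil : word [] = [] := rfl

lemma toBlocks : ∀ (n : ℕ) (P L : List Endpoint), L.length ≤ n → IsGaussDiagram (P ++ L) →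
    IsGaussDiagram L → ∃ B, IsGaussDiagram (P ++ word B) ∧ RelXi (P ++ L) (P ++ word B) := by
  intro n
  induction n with
  | zero =>
    intro P L hn h1 _
    have : L = [] := List.eq_nil_of_length_eq_zero (by omega)
    subst this
    exact ⟨[], h1, RelXi.rfl' _⟩
  | succ n ih =>
    intro P L hn hPL hL
    cases L with
    | nil => exact ⟨[], hPL, RelXi.rfl' _⟩
    | cons x R =>
      obtain ⟨w, B, rfl⟩ := G_partner hL
      by_cases hw : Even w.length
      · obtain ⟨r1, g1⟩ := evenRem P w B x hw hPL
        obtain ⟨-, g2⟩ := evenRem [] w B x hw hL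
        obtain ⟨D, g3, r2⟩ := ih P (psw w ++ B)
          (by simp [(psw_perm w).length_eq] at hn ⊢; omega) (by simpa using g1) (by simpa using g2)
        exact ⟨D, g3, r1.trans (by simpa using r2)⟩
      · cases w with
        | nil => simp at hw
        | cons y w =>
          have hw2 : Even w.length := by simp only [List.length_cons] at hw; grind
          set x' : Endpoint := ⟨x.label, !x.isTerminal, x.sign⟩ with hx'
          have hp1 : (x :: (y :: w ++ x' :: B)).Perm (x :: x' :: (y :: (psw w ++ B))) := by
            apply perm_of_count; intro e
            simp only [List.count_append, List.count_cons, (psw_perm w).count_eq]; omega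
          obtain ⟨f1, -, gy⟩ := G_pair (G_perm hp1 hL) rfl
          have r1 := moveL w (P ++ [x, y]) B x' hw2 (by simpa using hPL)
            (fun e he => f1 e (by simp [(psw_perm w).mem_iff, he]))
          have hp2 : (P ++ x :: (y :: w ++ x' :: B)).Perm (P ++ x :: y :: x' :: (psw w ++ B)) := by
            apply perm_of_count; intro e
            simp only [List.count_append, List.count_cons, (psw_perm w).count_eq]; omega
          have hlen : (psw w ++ B).length = w.length + B.length := by
            simp [(psw_perm w).length_eq]
          have r1' : RelXi (P ++ x :: (y :: w ++ x' :: B)) (P ++ x :: y :: x' :: (psw w ++ B)) := by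
            simpa using r1
          have gP := G_perm hp2 hPL
          have gL : IsGaussDiagram (x :: y :: x' :: (psw w ++ B)) :=
            G_perm (hp1.trans ((List.Perm.swap _ _ _).cons _)) hL
          clear r1 hp2 hPL hL hp1
          obtain ⟨v, C, hvC⟩ := G_partner gy
          rw [hvC] at gy gP gL r1' hlen f1
          set y' : Endpoint := ⟨y.label, !y.isTerminal, y.sign⟩ with hy'
          simp only [List.length_append, List.length_cons] at hn hlen
          have hp3 : (y :: (v ++ y' :: C)).Perm (y :: y' :: (psw v ++ C)) := by
            apply perm_of_count; intro e
            simp only [List.count_append, List.count_cons, (psw_perm v).count_eq]; omega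
          obtain ⟨f2, -, gv⟩ := G_pair (G_perm hp3 gy) rfl
          by_cases hv : Even v.length
          · have r2 := moveL v (P ++ [x, y, x']) C y' hv (by simpa using gP)
              (fun e he => f2 e (by simp [(psw_perm v).mem_iff, he]))
            have hp4 : (P ++ x :: y :: x' :: (v ++ y' :: C)).Perm
                ((P ++ [x, y, x', y']) ++ (psw v ++ C)) := by
              apply perm_of_count; intro e
              simp only [List.count_append, List.count_cons, (psw_perm v).count_eq,
                List.count_nil]; omega
            obtain ⟨D, g3, r3⟩ := ih (P ++ [x, y, x', y']) (psw v ++ C)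
              (by simp [(psw_perm v).length_eq]; omega) (G_perm hp4 gP) gv
            refine ⟨⟨x.label, y.label, x.isTerminal, y.isTerminal, x.sign, y.sign⟩ :: D, ?_, ?_⟩
            · simpa [bw] using g3
            · refine r1'.trans ?_
              have r2' : RelXi (P ++ x :: y :: x' :: (v ++ y' :: C))
                  ((P ++ [x, y, x', y']) ++ (psw v ++ C)) := by simpa using r2
              refine r2'.trans ?_
              simpa [bw] using r3
          · have hv' : Even (x' :: v).length := by simp only [List.length_cons]; grind
            obtain ⟨r2, g2⟩ := evenRem (P ++ [x]) (x' :: v) C y hv' (by simpa using gP)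
            obtain ⟨-, g2'⟩ := evenRem [x] (x' :: v) C y hv' (by simpa using gL)
            obtain ⟨D, g3, r3⟩ := ih P ([x] ++ psw (x' :: v) ++ C)
              (by simp [(psw_perm (x' :: v)).length_eq]; omega) (by simpa using g2) g2'
            refine ⟨D, g3, r1'.trans ?_⟩
            have r2' : RelXi (P ++ x :: y :: x' :: (v ++ y' :: C))
                  (P ++ ([x] ++ psw (x' :: v) ++ C)) := by simpa using r2
            exact r2'.trans r3

lemma block_fresh {b : Blk} {M : List Endpoint} (h : IsGaussDiagram (bw b ++ M)) :
    b.c ≠ b.d ∧ (∀ e ∈ M, e.label ≠ b.c ∧ e.label ≠ b.d) ∧ IsGaussDiagram M := by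
  have hp : (bw b ++ M).Perm (⟨b.c, b.t, b.s⟩ :: ⟨b.c, !b.t, b.s⟩ ::
      (⟨b.d, b.u, b.r⟩ :: ⟨b.d, !b.u, b.r⟩ :: M)) := by
    apply perm_of_count; intro e
    simp only [bw, List.count_append, List.count_cons, List.count_nil]; omega
  obtain ⟨h1, -, h2⟩ := G_pair (G_perm hp h) rfl
  obtain ⟨h3, -, h4⟩ := G_pair h2 rfl
  refine ⟨fun h => h1 ⟨b.d, b.u, b.r⟩ (by simp) h.symm, fun e he => ⟨h1 e (by simp [he]), h3 e he⟩, h4⟩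

/-- Swap the two chords of a block. -/
def sw (b : Blk) : Blk := ⟨b.d, b.c, b.u, b.t, b.r, b.s⟩

/-- Turn a block. -/
def rt (b : Blk) : Blk := ⟨b.d, b.c, b.u, !b.t, b.r, b.s⟩

lemma psw_word (B : List Blk) : psw (word B) = word (B.map sw) := by
  induction B with
  | nil => simp [psw]
  | cons b B ih => simp [bw, psw, ih, sw]

lemma word_even (B : List Blk) : Even (word B).length := by
  induction B with
  | nil => simp
  | cons b B ih => simp [bw]; grind

lemma word_rot (P Q : List Blk) : RelXi (word (P ++ Q)) (word (Q ++ P)) := by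
  simpa using relXi_rotate (word P) (word Q)

lemma word_rotG {P Q : List Blk} (h : IsGaussDiagram (word (P ++ Q))) :
    IsGaussDiagram (word (Q ++ P)) := by
  rw [word_append] at *
  exact G_perm List.perm_append_comm h

lemma rop (b : Blk) (Q : List Blk) (h : IsGaussDiagram (word (b :: Q))) :
    RelXi (word (b :: Q)) (word (rt b :: Q.map sw)) ∧
      IsGaussDiagram (word (rt b :: Q.map sw)) := by
  have hp : (word (b :: Q)).Perm ([⟨b.d, b.u, b.r⟩, ⟨b.c, !b.t, b.s⟩, ⟨b.d, !b.u, b.r⟩] ++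
      word Q ++ [⟨b.c, b.t, b.s⟩]) := by
    apply perm_of_count; intro e
    simp only [word_cons, bw, List.count_append, List.count_cons, List.count_nil]; omega
  have hp2 : (word (b :: Q)).Perm (word (rt b :: Q.map sw)) := by
    apply perm_of_count; intro e
    rw [word_cons, word_cons, ← psw_word]
    simp only [bw, rt, Bool.not_not, List.count_append, List.count_cons, List.count_nil,
      (psw_perm _).count_eq]; omega
  obtain ⟨-, h2, -⟩ := block_fresh (by simpa using h)
  have r1 : RelXi (word (b :: Q)) ([⟨b.d, b.u, b.r⟩, ⟨b.c, !b.t, b.s⟩, ⟨b.d, !b.u, b.r⟩] ++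
      word Q ++ [⟨b.c, b.t, b.s⟩]) := by
    have := relXi_rotate [⟨b.c, b.t, b.s⟩]
      ([⟨b.d, b.u, b.r⟩, ⟨b.c, !b.t, b.s⟩, ⟨b.d, !b.u, b.r⟩] ++ word Q)
    simpa [bw] using this
  have r2 := moveL (word Q) [⟨b.d, b.u, b.r⟩, ⟨b.c, !b.t, b.s⟩, ⟨b.d, !b.u, b.r⟩] []
    ⟨b.c, b.t, b.s⟩ (word_even Q) (G_perm hp h) (fun e he => (h2 e he).1)
  refine ⟨r1.trans ?_, G_perm hp2 h⟩
  rw [psw_word] at r2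
  simpa [bw, rt] using r2

lemma rem2 (b : Blk) (Q : List Blk) (h : IsGaussDiagram (word (b :: Q))) (ht : b.t = false)
    (hu : b.u = false) (hr : b.r = !b.s) :
    RelXi (word (b :: Q)) (word Q) ∧ IsGaussDiagram (word Q) := by
  rw [word_cons] at h
  obtain ⟨h1, h2, h3⟩ := block_fresh h
  refine ⟨.of_reid (Or.inr (Or.inr (Or.inr (Or.inl
    ⟨[], [], word Q, b.c, b.d, b.s, true, h1, ?_, ?_, ?_, ?_⟩)))), h3⟩
  · intro hc
    obtain ⟨e, he, h'⟩ := List.mem_map.1 hc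
    exact (h2 e (by simpa using he)).1 h'
  · intro hc
    obtain ⟨e, he, h'⟩ := List.mem_map.1 hc
    exact (h2 e (by simpa using he)).2 h'
  · simp [bw, ht, hu, hr]
  · simp

/-- A block in normal form. -/
def Nice (b : Blk) : Prop := b.t = false ∧ b.u = false ∧ b.r = b.s

lemma Nice.sw {b : Blk} (h : Nice b) : Nice (sw b) := ⟨h.2.1, h.1, h.2.2.symm⟩

lemma stage1 : ∀ (n : ℕ) (Q P : List Blk), Q.length = n → (∀ b ∈ P, Nice b) →
    IsGaussDiagram (word (Q ++ P)) →
    ∃ B, (∀ b ∈ B, Nice b) ∧ IsGaussDiagram (word B) ∧ RelXi (word (Q ++ P)) (word B) := by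
  intro n
  induction n with
  | zero =>
    intro Q P hn hP hG
    have : Q = [] := List.eq_nil_of_length_eq_zero hn
    subst this
    exact ⟨P, hP, hG, RelXi.rfl' _⟩
  | succ n ih =>
    have ff : ∀ (b : Blk) (Q P : List Blk), Q.length = n → (∀ b ∈ P, Nice b) →
        IsGaussDiagram (word (b :: (Q ++ P))) → b.t = false → b.u = false →
        ∃ B, (∀ b ∈ B, Nice b) ∧ IsGaussDiagram (word B) ∧
          RelXi (word (b :: (Q ++ P))) (word B) := by
      intro b Q P hn hP hG ht hu
      by_cases hr : b.r = b.s
      · obtain ⟨B, h1, h2, h3⟩ := ih Q (P ++ [b]) hn (by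
          intro x hx
          simp only [List.mem_append, List.mem_singleton] at hx
          rcases hx with hx | rfl
          · exact hP x hx
          · exact ⟨ht, hu, hr⟩) (by
            have := word_rotG (P := [b]) (Q := Q ++ P) hG
            rwa [List.append_assoc] at this)
        refine ⟨B, h1, h2, RelXi.trans (word_rot [b] (Q ++ P)) ?_⟩
        rwa [List.append_assoc]
      · have hr' : b.r = !b.s := by
          cases h1 : b.r <;> cases h2 : b.s <;> simp_all
        obtain ⟨r1, g1⟩ := rem2 b _ hG ht hu hr'
        obtain ⟨B, h1, h2, h3⟩ := ih Q P hn hP g1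
        exact ⟨B, h1, h2, r1.trans h3⟩
    have step : ∀ (t u t' u' : Bool),
        (∀ (b : Blk) (Q P : List Blk), Q.length = n → (∀ b ∈ P, Nice b) →
        IsGaussDiagram (word (b :: (Q ++ P))) → b.t = t → b.u = u →
        ∃ B, (∀ b ∈ B, Nice b) ∧ IsGaussDiagram (word B) ∧
          RelXi (word (b :: (Q ++ P))) (word B)) → t = u' → u = !t' →
        (∀ (b : Blk) (Q P : List Blk), Q.length = n → (∀ b ∈ P, Nice b) →
        IsGaussDiagram (word (b :: (Q ++ P))) → b.t = t' → b.u = u' →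
        ∃ B, (∀ b ∈ B, Nice b) ∧ IsGaussDiagram (word B) ∧
          RelXi (word (b :: (Q ++ P))) (word B)) := by
      intro t u t' u' H e1 e2 b Q P hn hP hG ht hu
      obtain ⟨r1, g1⟩ := rop b _ hG
      rw [List.map_append] at r1 g1
      obtain ⟨B, h1, h2, h3⟩ := H (rt b) (Q.map sw) (P.map sw) (by simpa using hn) (by
        intro x hx
        obtain ⟨y, hy, rfl⟩ := List.mem_map.1 hx
        exact (hP y hy).sw) g1 (by simp [rt, hu, e1]) (by simp [rt, ht, e2])
      exact ⟨B, h1, h2, r1.trans h3⟩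
    have tf := step false false true false ff rfl rfl
    have tt := step true false true true tf rfl rfl
    have ft := step true true false true tt rfl rfl
    intro Q P hn hP hG
    cases Q with
    | nil => simp at hn
    | cons b Q =>
      have hn' : Q.length = n := by simpa using hn
      rw [List.cons_append] at *
      cases ht : b.t <;> cases hu : b.u
      · exact ff b Q P hn' hP hG ht hu
      · exact ft b Q P hn' hP hG ht hu
      · exact tf b Q P hn' hP hG ht hu
      · exact tt b Q P hn' hP hG ht hu

lemma cancel2 (p b : Blk) (Q : List Blk) (hp : Nice p) (hb : Nice b) (hs : b.s = !p.s)
    (h : IsGaussDiagram (word (p :: b :: Q))) :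
    RelXi (word (p :: b :: Q)) (word Q) ∧ IsGaussDiagram (word Q) := by
  obtain ⟨c, d, t, u, s, r⟩ := p
  obtain ⟨a, e, t', u', s', r'⟩ := b
  obtain ⟨h1, h2, h3⟩ := hp
  obtain ⟨h4, h5, h6⟩ := hb
  dsimp only at h1 h2 h3 h4 h5 h6 hs
  subst h1 h2 h3 h4 h5 h6 hs
  have h' := h
  rw [word_cons] at h'
  obtain ⟨-, f1, g1⟩ := block_fresh h'
  rw [word_cons] at g1
  obtain ⟨f2, f3, g2⟩ := block_fresh g1
  have fa := f1 ⟨a, false, !r⟩ (by simp [bw])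
  have fe := f1 ⟨e, false, !r⟩ (by simp [bw])
  dsimp only at fa fe f2
  have m1 := moveL [⟨d, false, r⟩, ⟨c, true, r⟩, ⟨d, true, r⟩, ⟨a, false, !r⟩] [⟨c, false, r⟩]
    (⟨a, true, !r⟩ :: ⟨e, true, !r⟩ :: word Q) ⟨e, false, !r⟩ (by simp; decide)
    (by simpa [bw] using h) (by
      intro x hx; simp at hx
      rcases hx with rfl | rfl | rfl | rfl <;> simp [f2, fe.1.symm, fe.2.symm])
  have hg2 : IsGaussDiagram ([⟨c, false, r⟩, ⟨e, false, !r⟩, ⟨c, true, r⟩] ++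
      [⟨d, false, r⟩, ⟨a, false, !r⟩, ⟨d, true, r⟩, ⟨a, true, !r⟩] ++
      ⟨e, true, !r⟩ :: word Q) := by
    refine G_perm ?_ h
    apply perm_of_count; intro e
    simp only [word_cons, bw, List.count_append, List.count_cons, List.count_nil, Bool.not_false]
    omega
  have m2 := moveL [⟨d, false, r⟩, ⟨a, false, !r⟩, ⟨d, true, r⟩, ⟨a, true, !r⟩]
    [⟨c, false, r⟩, ⟨e, false, !r⟩, ⟨c, true, r⟩] (word Q) ⟨e, true, !r⟩ (by simp; decide) hg2 (by
      intro x hx; simp at hx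
      rcases hx with rfl | rfl | rfl | rfl <;> simp [f2, fe.1.symm, fe.2.symm])
  have hg3 : IsGaussDiagram (word (⟨c, e, false, false, r, !r⟩ :: ⟨a, d, false, false, !r, r⟩ :: Q)) := by
    refine G_perm ?_ h
    apply perm_of_count; intro e
    simp only [word_cons, bw, List.count_append, List.count_cons, List.count_nil, Bool.not_false]
    omega
  obtain ⟨r3, g3⟩ := rem2 _ _ hg3 rfl rfl rfl
  obtain ⟨r4, g4⟩ := rem2 _ _ g3 rfl rfl (by simp)
  refine ⟨?_, g4⟩
  have m12 := RelXi.trans (by simpa [psw] using m1) (by simpa [psw] using m2)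
  refine RelXi.trans ?_ (r3.trans r4)
  simpa [bw] using m12

lemma stage2 : ∀ (n : ℕ) (P Q : List Blk) (s : Bool), Q.length = n →
    (∀ b ∈ P, Nice b ∧ b.s = s) → (∀ b ∈ Q, Nice b) → IsGaussDiagram (word (P ++ Q)) →
    ∃ B s, (∀ b ∈ B, Nice b ∧ b.s = s) ∧ IsGaussDiagram (word B) ∧
      RelXi (word (P ++ Q)) (word B) := by
  intro n
  induction n with
  | zero =>
    intro P Q s hn hP hQ hG
    have : Q = [] := List.eq_nil_of_length_eq_zero hn
    subst this
    rw [List.append_nil] at *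
    exact ⟨P, s, hP, hG, RelXi.rfl' _⟩
  | succ n ih =>
    intro P Q s hn hP hQ hG
    cases Q with
    | nil => simp at hn
    | cons b Q =>
      have hn' : Q.length = n := by simpa using hn
      have hb : Nice b := hQ b (by simp)
      have hQ' : ∀ b ∈ Q, Nice b := fun x hx => hQ x (by simp [hx])
      have app : ∀ s', (∀ x ∈ P, Nice x ∧ x.s = s') → b.s = s' →
          ∃ B s, (∀ b ∈ B, Nice b ∧ b.s = s) ∧ IsGaussDiagram (word B) ∧
            RelXi (word (P ++ b :: Q)) (word B) := by
        intro s' hP' hs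
        have := ih (P ++ [b]) Q s' hn' (by
          intro x hx
          simp only [List.mem_append, List.mem_singleton] at hx
          rcases hx with hx | rfl
          · exact hP' x hx
          · exact ⟨hb, hs⟩) hQ' (by simpa using hG)
        simpa using this
      by_cases hs : b.s = s
      · exact app s hP hs
      rcases List.eq_nil_or_concat P with rfl | ⟨P', p, rfl⟩
      · exact app b.s (by simp) rfl
      rw [List.concat_eq_append] at *
      have hp := hP p (by simp)
      have e1 : P' ++ [p] ++ b :: Q = P' ++ (p :: b :: Q) := by simp
      rw [e1] at hG ⊢
      have r1 := word_rot P' (p :: b :: Q)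
      have g1 := word_rotG hG
      have hs' : b.s = !p.s := by
        rw [hp.2]; cases h1 : b.s <;> cases h2 : s <;> simp_all
      obtain ⟨r2, g2⟩ := cancel2 p b (Q ++ P') hp.1 hb hs' g1
      obtain ⟨B, s', h1, h2, h3⟩ := ih P' Q s hn' (fun x hx => hP x (by simp [hx])) hQ'
        (word_rotG g2)
      exact ⟨B, s', h1, h2, r1.trans (r2.trans ((word_rot Q P').trans h3))⟩

lemma normal_form {G : List Endpoint} (h : IsGaussDiagram G) :
    ∃ B s, (∀ b ∈ B, Nice b ∧ b.s = s) ∧ IsGaussDiagram (word B) ∧ RelXi G (word B) := by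
  obtain ⟨B, g1, r1⟩ := toBlocks _ [] G le_rfl h h
  rw [List.nil_append] at g1 r1
  obtain ⟨B2, n2, g2, r2⟩ := stage1 _ B [] rfl (by simp) (by simpa using g1)
  obtain ⟨B3, s, n3, g3, r3⟩ := stage2 _ [] B2 true rfl (by simp) n2 g2
  rw [List.append_nil] at r2
  exact ⟨B3, s, n3, g3, r1.trans (r2.trans r3)⟩

lemma KK_word (s : Bool) : ∀ (B : List Blk), (∀ b ∈ B, Nice b ∧ b.s = s) →
    IsGaussDiagram (word B) → KK (word B) = 16 * B.length * (if s then 1 else -1) := by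
  intro B
  induction B with
  | nil => intro _ _; simp [KK]
  | cons b B ih =>
    intro hB hG
    rw [word_cons] at hG
    obtain ⟨f1, f2, g⟩ := block_fresh hG
    have ih' := ih (fun x hx => hB x (by simp [hx])) g
    obtain ⟨⟨h1, h2, h3⟩, h4⟩ := hB b (by simp)
    have hc : b.c ∉ labels (word B) := by
      intro hc
      obtain ⟨e, he, h'⟩ := List.mem_map.1 hc
      exact (f2 e he).1 h'
    have hd : b.d ∉ labels (word B) := by
      intro hc
      obtain ⟨e, he, h'⟩ := List.mem_map.1 hc
      exact (f2 e he).2 h'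
    have := KK_insert [] (bw b) [] [] (word B) (by simp [bw]; decide) (by simp) (by
      intro e he
      simp [bw] at he
      rcases he with rfl | rfl | rfl | rfl <;> simpa)
    simp only [List.nil_append, List.append_nil] at this
    rw [word_cons, this, ih']
    simp [alt_append, alt_not_mem _ _ hc, alt_not_mem _ _ hd, bw, alt, signValue, f1, f1.symm,
      h3, h4]
    cases s <;> simp <;> ring

/-- Labels of a list of blocks. -/
def ls (B : List Blk) : List ℕ := B.flatMap (fun b => [b.c, b.d])

lemma ls_cons (b : Blk) (B : List Blk) : ls (b :: B) = b.c :: b.d :: ls B := by simp [ls]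

lemma ls_sub (B : List Blk) : ∀ c ∈ ls B, ∃ e ∈ word B, e.label = c := by
  intro c hc
  simp only [ls, List.mem_flatMap] at hc
  obtain ⟨b, hb, hc⟩ := hc
  simp only [word, List.mem_flatMap]
  simp only [List.mem_cons, List.not_mem_nil, or_false] at hc
  rcases hc with rfl | rfl
  · exact ⟨⟨b.c, b.t, b.s⟩, ⟨b, hb, by simp [bw]⟩, rfl⟩
  · exact ⟨⟨b.d, b.u, b.r⟩, ⟨b, hb, by simp [bw]⟩, rfl⟩

lemma ls_nodup : ∀ (B : List Blk), IsGaussDiagram (word B) → (ls B).Nodup := by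
  intro B
  induction B with
  | nil => intro _; simp [ls]
  | cons b B ih =>
    intro hG
    rw [word_cons] at hG
    obtain ⟨f1, f2, g⟩ := block_fresh hG
    rw [ls_cons, List.nodup_cons, List.nodup_cons]
    refine ⟨?_, ?_, ih g⟩
    · intro hc
      rcases List.mem_cons.1 hc with h | h
      · exact f1 h
      · obtain ⟨e, he, h'⟩ := ls_sub B _ h
        exact (f2 e he).1 h'
    · intro h
      obtain ⟨e, he, h'⟩ := ls_sub B _ h
      exact (f2 e he).2 h'

/-- Canonical words. -/
def can (s : Bool) : ℕ → ℕ → List Endpoint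
  | _, 0 => []
  | k, n + 1 => bw ⟨2 * k, 2 * k + 1, false, false, s, s⟩ ++ can s (k + 1) n

lemma can_map (s : Bool) (f : ℕ → ℕ) : ∀ (B : List Blk) (k : ℕ), (∀ b ∈ B, Nice b ∧ b.s = s) →
    (∀ j (h : j < (ls B).length), f (2 * k + j) = (ls B)[j]) →
    word B = (can s k B.length).map (fun e => Endpoint.mk (f e.label) e.isTerminal e.sign) := by
  intro B
  induction B with
  | nil => intro _ _ _; rfl
  | cons b B ih =>
    intro k hB hf
    have e1 := hf 0 (by simp [ls_cons])
    have e2 := hf 1 (by simp [ls_cons])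
    have e3 := ih (k + 1) (fun x hx => hB x (by simp [hx])) (by
      intro j hj
      have := hf (j + 2) (by simp [ls_cons]; omega)
      rw [show 2 * (k + 1) + j = 2 * k + (j + 2) by ring, this]
      simp [ls_cons])
    simp only [ls_cons, List.getElem_cons_zero, List.getElem_cons_succ, add_zero] at e1 e2
    obtain ⟨⟨h1, h2, h3⟩, h4⟩ := hB b (by simp)
    rw [word_cons, List.length_cons, can, List.map_append, ← e3]
    simp [bw, e1, e2, h1, h2, h3, h4]

lemma rel_can (s : Bool) (B : List Blk) (hB : ∀ b ∈ B, Nice b ∧ b.s = s)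
    (hG : IsGaussDiagram (word B)) : RelXi (word B) (can s 0 B.length) := by
  have hnd := ls_nodup B hG
  set f : ℕ → ℕ := fun i => if h : i < (ls B).length then (ls B)[i] else (ls B).sum + 1 + i with hf
  have hle : ∀ i (h : i < (ls B).length), (ls B)[i] ≤ (ls B).sum := fun i h =>
    List.le_sum_of_mem (List.getElem_mem h)
  have hinj : Function.Injective f := by
    intro i j hij
    simp only [hf] at hij
    split at hij <;> split at hij
    · exact (List.Nodup.getElem_inj_iff hnd).1 hij
    · rename_i h1 h2; have := hle i h1; omega
    · rename_i h1 h2; have := hle j h2; omega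
    · omega
  refine RelXi.symm (.of_reid (Or.inr (Or.inl ⟨f, hinj, can_map s f B 0 hB ?_⟩)))
  intro j hj
  simp only [hf, mul_zero, zero_add, dif_pos hj]

end Gauss

open Gauss in
/-- if two virtual knots are related by a finite sequence of
2k-moves for every positive integer k, then they are related by a finite
sequence of Ξ-moves (and Reidemeister moves). -/
theorem relXi_of_forall_rel2k
    (G G' : List Endpoint) (hG : IsGaussDiagram G) (hG' : IsGaussDiagram G')
    (h : ∀ k : ℕ, 0 < k → Rel2k k G G') :
    RelXi G G' := by
  have hK := KK_eq_of_rel2k (G_WW hG) h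
  obtain ⟨B, s, hB, gB, rB⟩ := normal_form hG
  obtain ⟨B', s', hB', gB', rB'⟩ := normal_form hG'
  rw [KK_eq_of_relXi (G_WW hG) rB, KK_eq_of_relXi (G_WW hG') rB', KK_word s B hB gB,
    KK_word s' B' hB' gB'] at hK
  have r1 := rB.trans (rel_can s B hB gB)
  have r2 := rB'.trans (rel_can s' B' hB' gB')
  have hc : can s 0 B.length = can s' 0 B'.length := by
    have hl : B.length = B'.length := by
      cases s <;> cases s' <;> simp at hK <;> omega
    rcases Nat.eq_zero_or_pos B.length with h0 | h0
    · rw [← hl, h0]; rfl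
    · have : s = s' := by
        cases s <;> cases s' <;> simp at hK ⊢ <;> omega
      rw [hl, this]
  rw [hc] at r1
  exact r1.trans r2.symm
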